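/- arXiv:2110.07320 — 4 statements merged into one kernel-verified Lean document; each statement's English description precedes it below -/
import Mathlib

section
/- Let I be a nonempty index set and for each i ∈ I let φ_i : ℝ → ℝ be convex on the open interval (0,1). Assume that for each i ∈ I the one-sided limit L_i := lim_{u→0+} φ_i(u) exists in (−∞,+∞], and define φ(u) := sup_{i∈I} φ_i(u) ∈ (−∞,+∞] for u ∈ (0,1). If φ(u₀) < +∞ for some u₀ ∈ (0,1), then φ(u) converges, as u → 0 within (0,1), to sup_{i∈I} L_i in the extended reals (−∞,+∞]. -/
/-- A convex function on `(0,1)` whose limit at `0` is below `s` lies below the chord joining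
`(0, s)` to `(u₀, M)`, whenever `M` bounds both its value at `u₀` and `s`. -/
theorem convexOn_Ioo_le_of_tendsto_nhdsWithin_zero {f : ℝ → ℝ}
    (hf : ConvexOn ℝ (Set.Ioo (0 : ℝ) 1) f) {l : EReal}
    (hl : Filter.Tendsto (fun u => ((f u : ℝ) : EReal))
      (nhdsWithin 0 (Set.Ioo (0 : ℝ) 1)) (nhds l))
    {s M u₀ u : ℝ} (hls : l < s) (hu₀ : u₀ ∈ Set.Ioo (0 : ℝ) 1) (hM : f u₀ ≤ M) (hsM : s ≤ M)
    (hu : 0 < u) (huu₀ : u < u₀) : f u ≤ s + u / u₀ * (M - s) := by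
  have : (nhdsWithin (0 : ℝ) (Set.Ioo (0 : ℝ) 1)).NeBot := by
    rw [nhdsWithin_Ioo_eq_nhdsGT one_pos]
    infer_instance
  obtain ⟨v, hvs, hv01, hvu⟩ := ((hl.eventually_lt_const hls).and
    (Filter.Eventually.and self_mem_nhdsWithin
      (mem_nhdsWithin_of_mem_nhds (Iio_mem_nhds hu)))).exists
  have hvu : v < u := hvu
  have hv : 0 < v := hv01.1
  have hvs : f v < s := by exact_mod_cast hvs
  have hd : 0 < u₀ - v := by linarith
  have hw : (u - v) / (u₀ - v) ≤ u / u₀ := by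
    rw [div_le_div_iff₀ hd hu₀.1]
    nlinarith
  have hw0 : 0 ≤ (u - v) / (u₀ - v) := div_nonneg (by linarith) hd.le
  have hw1 : (u - v) / (u₀ - v) ≤ 1 := (div_le_one hd).2 (by linarith)
  have hcomb : (1 - (u - v) / (u₀ - v)) * v + (u - v) / (u₀ - v) * u₀ = u := by
    field_simp
    ring
  have hconv := hf.2 hv01 hu₀ (sub_nonneg.2 hw1) hw0 (sub_add_cancel _ _)
  simp only [smul_eq_mul, hcomb] at hconv
  have h₁ := mul_le_mul_of_nonneg_left hvs.le (sub_nonneg.2 hw1)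
  have h₂ := mul_le_mul_of_nonneg_left hM hw0
  have h₃ := mul_le_mul_of_nonneg_right hw (sub_nonneg.2 hsM)
  linarith


/-- **Boundary values of suprema of convex functions on (0,1), at 0.**
Let `I` be a nonempty index set and for each `i ∈ I` let `φ_i : ℝ → ℝ` be convex on `(0,1)`.
Assume that for each `i` the one-sided limit `L i = lim_{u→0+} φ_i(u)` exists in `(−∞,+∞]`,
and let `φ(u) = sup_i φ_i(u)` (as an extended real) for `u ∈ (0,1)`.  If `φ(u₀) < +∞` for
some `u₀ ∈ (0,1)`, then `φ(u) → sup_i L i` as `u → 0` within `(0,1)`. -/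
theorem sup_convexOn_tendsto_nhdsWithin_zero
    {I : Type*} [Nonempty I] (φi : I → ℝ → ℝ)
    (hconv : ∀ i, ConvexOn ℝ (Set.Ioo (0 : ℝ) 1) (φi i))
    (L : I → EReal) (hLbot : ∀ i, L i ≠ ⊥)
    (hL : ∀ i, Filter.Tendsto (fun u => ((φi i u : ℝ) : EReal))
      (nhdsWithin 0 (Set.Ioo (0 : ℝ) 1)) (nhds (L i)))
    (φ : ℝ → EReal)
    (hφ : ∀ u ∈ Set.Ioo (0 : ℝ) 1, φ u = ⨆ i, ((φi i u : ℝ) : EReal))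
    (u₀ : ℝ) (hu₀ : u₀ ∈ Set.Ioo (0 : ℝ) 1) (hfin : φ u₀ < ⊤) :
    Filter.Tendsto φ (nhdsWithin 0 (Set.Ioo (0 : ℝ) 1)) (nhds (⨆ i, L i)) := by
  refine tendsto_order.2 ⟨fun a ha => ?_, fun a ha => ?_⟩
  · obtain ⟨i, hi⟩ := lt_iSup_iff.1 ha
    filter_upwards [(hL i).eventually_const_lt hi, self_mem_nhdsWithin] with u hu hu01
    rw [hφ u hu01]
    exact hu.trans_le (le_iSup (fun j => ((φi j u : ℝ) : EReal)) i)
  · obtain ⟨s, hs, hsa⟩ := EReal.lt_iff_exists_real_btwn.1 ha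
    obtain ⟨t, hst, hta⟩ := EReal.lt_iff_exists_real_btwn.1 hsa
    obtain ⟨M₀, hM₀, -⟩ := EReal.lt_iff_exists_real_btwn.1 hfin
    have hst' : s < t := by exact_mod_cast hst
    have hM : ∀ i, φi i u₀ ≤ max M₀ s := fun i => by
      have h := (le_iSup (fun j => ((φi j u₀ : ℝ) : EReal)) i).trans_lt ((hφ u₀ hu₀) ▸ hM₀)
      have h' : φi i u₀ < M₀ := by exact_mod_cast h
      exact h'.le.trans (le_max_left _ _)
    have hlim : Filter.Tendsto (fun u : ℝ => s + u / u₀ * (max M₀ s - s))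
        (nhdsWithin 0 (Set.Ioo (0 : ℝ) 1)) (nhds s) := by
      have hc : Continuous (fun u : ℝ => s + u / u₀ * (max M₀ s - s)) := by fun_prop
      simpa using (hc.tendsto 0).mono_left nhdsWithin_le_nhds
    filter_upwards [hlim.eventually_lt_const hst', self_mem_nhdsWithin,
      mem_nhdsWithin_of_mem_nhds (Iio_mem_nhds hu₀.1)] with u hut hu01 huu₀
    rw [hφ u hu01]
    refine (iSup_le fun i => ?_).trans_lt hta
    exact_mod_cast (convexOn_Ioo_le_of_tendsto_nhdsWithin_zero (hconv i) (hL i)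
      ((le_iSup L i).trans_lt hs) hu₀ (hM i) (le_max_right _ _) hu01.1 huu₀).trans hut.le
end

section
/- Let I be a nonempty index set and for each i ∈ I let φ_i : ℝ → ℝ be convex on the open interval (0,1). Assume that for each i ∈ I the one-sided limit M_i := lim_{u→1−} φ_i(u) exists in (−∞,+∞], and define φ(u) := sup_{i∈I} φ_i(u) ∈ (−∞,+∞] for u ∈ (0,1). If φ(u₀) < +∞ for some u₀ ∈ (0,1), then φ(u) converges, as u → 1 within (0,1), to sup_{i∈I} M_i in the extended reals (−∞,+∞]. -/
open Filter Set Topology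

/-- A convex function on `(0,1)` with finite limit `m` at `1` lies below its chord
through `(x, f x)` and `(1, m)`. -/
theorem ConvexOn.mul_le_of_tendsto_one {f : ℝ → ℝ} (hf : ConvexOn ℝ (Ioo (0 : ℝ) 1) f)
    {m x y : ℝ} (hm : Tendsto f (𝓝[Ioo 0 1] 1) (𝓝 m)) (hx : 0 < x) (hxy : x < y) (hy : y < 1) :
    (1 - x) * f y ≤ (1 - y) * f x + (y - x) * m := by
  have : (𝓝[Ioo (0 : ℝ) 1] 1).NeBot := right_nhdsWithin_Ioo_neBot one_pos
  have hid : Tendsto (fun z : ℝ => z) (𝓝[Ioo (0 : ℝ) 1] 1) (𝓝 1) :=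
    tendsto_id.mono_left nhdsWithin_le_nhds
  refine le_of_tendsto_of_tendsto ((hid.sub_const x).mul_const (f y))
    (((hid.sub_const y).mul_const (f x)).add (hm.const_mul (y - x))) ?_
  filter_upwards [self_mem_nhdsWithin, mem_nhdsWithin_of_mem_nhds (Ioi_mem_nhds hy)]
    with z hz hyz
  exact hf.secant_mono_aux1 ⟨hx, hxy.trans hy⟩ hz hxy hyz

/-- **Boundary values of suprema of convex functions on (0,1), at 1.**
Let `I` be a nonempty index set and for each `i ∈ I` let `φ_i : ℝ → ℝ` be convex on `(0,1)`.
Assume that for each `i` the one-sided limit `M i = lim_{u→1−} φ_i(u)` exists in `(−∞,+∞]`,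
and let `φ(u) = sup_i φ_i(u)` (as an extended real) for `u ∈ (0,1)`.  If `φ(u₀) < +∞` for
some `u₀ ∈ (0,1)`, then `φ(u) → sup_i M i` as `u → 1` within `(0,1)`. -/
theorem sup_convexOn_tendsto_nhdsWithin_one
    {I : Type*} [Nonempty I] (φi : I → ℝ → ℝ)
    (hconv : ∀ i, ConvexOn ℝ (Set.Ioo (0 : ℝ) 1) (φi i))
    (M : I → EReal) (hMbot : ∀ i, M i ≠ ⊥)
    (hM : ∀ i, Filter.Tendsto (fun u => ((φi i u : ℝ) : EReal))
      (nhdsWithin 1 (Set.Ioo (0 : ℝ) 1)) (nhds (M i)))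
    (φ : ℝ → EReal)
    (hφ : ∀ u ∈ Set.Ioo (0 : ℝ) 1, φ u = ⨆ i, ((φi i u : ℝ) : EReal))
    (u₀ : ℝ) (hu₀ : u₀ ∈ Set.Ioo (0 : ℝ) 1) (hfin : φ u₀ < ⊤) :
    Filter.Tendsto φ (nhdsWithin 1 (Set.Ioo (0 : ℝ) 1)) (nhds (⨆ i, M i)) := by
  refine tendsto_order.2 ⟨fun a ha => ?_, fun b hb => ?_⟩
  · obtain ⟨i, hi⟩ := lt_iSup_iff.1 ha
    filter_upwards [(hM i).eventually_const_lt hi, self_mem_nhdsWithin] with u hu hu01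
    rw [hφ u hu01]
    exact lt_iSup_iff.2 ⟨i, hu⟩
  · obtain ⟨s, hs, hsb⟩ := EReal.lt_iff_exists_real_btwn.1 hb
    obtain ⟨C, hC, -⟩ := EReal.lt_iff_exists_real_btwn.1 hfin
    rw [hφ u₀ hu₀] at hC
    have hpos : 0 < 1 - u₀ := sub_pos.2 hu₀.2
    have hchord : Tendsto (fun u : ℝ => ((1 - u) * C + (u - u₀) * s) / (1 - u₀))
        (𝓝[Ioo 0 1] 1) (𝓝 s) := by
      have hcont : Continuous fun u : ℝ => ((1 - u) * C + (u - u₀) * s) / (1 - u₀) := by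
        fun_prop
      have h := hcont.tendsto 1
      have hval : ((1 - 1) * C + (1 - u₀) * s) / (1 - u₀) = s := by
        field_simp
        ring
      rw [hval] at h
      exact h.mono_left nhdsWithin_le_nhds
    filter_upwards [(EReal.tendsto_coe.2 hchord).eventually_lt_const hsb, self_mem_nhdsWithin,
      mem_nhdsWithin_of_mem_nhds (Ioi_mem_nhds hu₀.2)] with u hu hu01 hu₀u
    rw [hφ u hu01]
    refine (iSup_le fun i => ?_).trans_lt hu
    have hMs : M i < s := (le_iSup M i).trans_lt hs
    have hC' : φi i u₀ < C := EReal.coe_lt_coe_iff.1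
      ((le_iSup (fun j => ((φi j u₀ : ℝ) : EReal)) i).trans_lt hC)
    have hlim := hM i
    lift M i to ℝ using ⟨(hMs.trans (EReal.coe_lt_top s)).ne, hMbot i⟩ with m
    have hms : m < s := EReal.coe_lt_coe_iff.1 hMs
    have h := (hconv i).mul_le_of_tendsto_one (EReal.tendsto_coe.1 hlim) hu₀.1 hu₀u hu01.2
    rw [EReal.coe_le_coe_iff, le_div_iff₀ hpos, mul_comm]
    exact h.trans (add_le_add
      (mul_le_mul_of_nonneg_left hC'.le (sub_nonneg.2 hu01.2.le))
      (mul_le_mul_of_nonneg_left hms.le (sub_nonneg.2 (le_of_lt hu₀u))))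
end

section
/- Let ρ and σ be density matrices on ℂ^d, and suppose there exists γ > 0 such that σ·s(ρ) = s(ρ)·σ and ρ = γ·σ·s(ρ). Then D(ρ‖σ) = log γ and D_max(ρ‖σ) = log γ; in particular D(ρ‖σ) = D_max(ρ‖σ). -/
open scoped ENNReal ComplexOrder Classical

namespace QRD

variable {n : Type*} [Fintype n] [DecidableEq n]

/-- Functional calculus for Hermitian matrices (junk value `0` otherwise). -/
noncomputable def matFun (A : Matrix n n ℂ) (f : ℝ → ℝ) : Matrix n n ℂ :=
  if hA : A.IsHermitian then
    (hA.eigenvectorUnitary : Matrix n n ℂ) *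
      Matrix.diagonal (fun i => (f (hA.eigenvalues i) : ℂ)) *
      (star (hA.eigenvectorUnitary : Matrix n n ℂ))
  else 0

/-- The support projection `s(A)` of a Hermitian matrix. -/
noncomputable def supp (A : Matrix n n ℂ) : Matrix n n ℂ :=
  matFun A (fun x => if x = 0 then 0 else 1)

/-- The functional-calculus power `A^t` taken on the support of `A`. -/
noncomputable def matPow (A : Matrix n n ℂ) (t : ℝ) : Matrix n n ℂ :=
  matFun A (fun x => if x = 0 then 0 else x ^ t)

/-- The functional-calculus logarithm taken on the support of `A`. -/
noncomputable def matLog (A : Matrix n n ℂ) : Matrix n n ℂ :=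
  matFun A Real.log

/-- `suppLE ρ σ` means `s(ρ) ≤ s(σ)`, i.e. `ker σ ⊆ ker ρ`. -/
def suppLE (ρ σ : Matrix n n ℂ) : Prop :=
  LinearMap.ker σ.mulVecLin ≤ LinearMap.ker ρ.mulVecLin

/-- Loewner order: `A ≤ B` iff `B - A` is positive semidefinite. -/
def loewnerLE (A B : Matrix n n ℂ) : Prop := (B - A).PosSemidef

/-- A density matrix: positive semidefinite with unit trace. -/
def IsDensityMatrix (ρ : Matrix n n ℂ) : Prop := ρ.PosSemidef ∧ ρ.trace = 1

/-- The quantity `Q^*_α(ρ‖σ)`, with values in `[0,∞]`. -/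
noncomputable def Qstar (α : ℝ) (ρ σ : Matrix n n ℂ) : ℝ≥0∞ :=
  if 1 < α ∧ ¬ suppLE ρ σ then ⊤
  else ENNReal.ofReal
    ((matPow (matPow σ ((1 - α) / (2 * α)) * ρ * matPow σ ((1 - α) / (2 * α))) α).trace.re)

/-- The sandwiched Rényi `α`-divergence `D^*_α(ρ‖σ)`. -/
noncomputable def Dstar (α : ℝ) (ρ σ : Matrix n n ℂ) : EReal :=
  (((α - 1)⁻¹ : ℝ) : EReal) * (Qstar α ρ σ).log

/-- The Hoeffding anti-divergence `H^*_r(ρ‖σ)`. -/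
noncomputable def Hstar (r : ℝ) (ρ σ : Matrix n n ℂ) : EReal :=
  ⨆ α ∈ Set.Ioi (1 : ℝ), ((((α - 1) / α : ℝ) : EReal) * ((r : EReal) - Dstar α ρ σ))

/-- The Umegaki relative entropy `D(ρ‖σ)`. -/
noncomputable def Drel (ρ σ : Matrix n n ℂ) : EReal :=
  if suppLE ρ σ then (((ρ * (matLog ρ - matLog σ)).trace.re : ℝ) : EReal) else ⊤

/-- The max-relative entropy `D_max(ρ‖σ)`. -/
noncomputable def Dmax (ρ σ : Matrix n n ℂ) : EReal :=
  if ∃ γ : ℝ, 0 ≤ γ ∧ loewnerLE ρ (γ • σ) then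
    ((Real.log (sInf {γ : ℝ | 0 ≤ γ ∧ loewnerLE ρ (γ • σ)}) : ℝ) : EReal)
  else ⊤

/-- The `n`-fold Kronecker tensor power of a `d × d` matrix. -/
noncomputable def tensorPow {d : ℕ} (ρ : Matrix (Fin d) (Fin d) ℂ) (N : ℕ) :
    Matrix (Fin N → Fin d) (Fin N → Fin d) ℂ :=
  Matrix.of fun x y => ∏ i, ρ (x i) (y i)

/-- A (quantum) test: `0 ≤ T ≤ 1` in the Loewner order. -/
def IsTest {m : Type*} [Fintype m] [DecidableEq m] (T : Matrix m m ℂ) : Prop :=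
  T.PosSemidef ∧ (1 - T).PosSemidef

/-- `-(1/n) log x`, with the convention `-log 0 = +∞`. -/
noncomputable def expRate (N : ℕ) (x : ℝ) : EReal :=
  if x = 0 then ⊤ else ((-(N : ℝ)⁻¹ * Real.log x : ℝ) : EReal)

end QRD

open QRD in
/-- An intertwining relation between Hermitian matrices passes to functions of them. -/
theorem QRD.matFun_mul_eq_mul_matFun {n : Type*} [Fintype n] [DecidableEq n]
    {A B X : Matrix n n ℂ} (hA : A.IsHermitian) (hB : B.IsHermitian) (c : ℝ)
    (h : A * X = c • (X * B)) (f g : ℝ → ℝ) (hfg : ∀ x, f (c * x) = g x) :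
    matFun A f * X = X * matFun B g := by
  set U := (hA.eigenvectorUnitary : Matrix n n ℂ) with hU
  set V := (hB.eigenvectorUnitary : Matrix n n ℂ) with hV
  have hUU : star U * U = 1 := Unitary.coe_star_mul_self _
  have hUU' : U * star U = 1 := Unitary.coe_mul_star_self _
  have hVV : star V * V = 1 := Unitary.coe_star_mul_self _
  have hVV' : V * star V = 1 := Unitary.coe_mul_star_self _
  have sA : A = U * Matrix.diagonal (fun i => (hA.eigenvalues i : ℂ)) * star U := by
    conv_lhs => rw [hA.spectral_theorem, Unitary.conjStarAlgAut_apply]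
    rfl
  have sB : B = V * Matrix.diagonal (fun i => (hB.eigenvalues i : ℂ)) * star V := by
    conv_lhs => rw [hB.spectral_theorem, Unitary.conjStarAlgAut_apply]
    rfl
  have key : Matrix.diagonal (fun i => (hA.eigenvalues i : ℂ)) * (star U * X * V)
      = c • ((star U * X * V) * Matrix.diagonal (fun i => (hB.eigenvalues i : ℂ))) := by
    have e : star U * (U * Matrix.diagonal (fun i => (hA.eigenvalues i : ℂ)) * star U * X) * V =
        star U * (c • (X * (V * Matrix.diagonal (fun i => (hB.eigenvalues i : ℂ)) * star V))) *
          V := by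
      rw [← sA, ← sB, h]
    calc _ = (star U * U) * Matrix.diagonal (fun i => (hA.eigenvalues i : ℂ)) *
          (star U * X * V) := by rw [hUU, one_mul]
      _ = _ := by simpa only [Matrix.mul_assoc] using e
      _ = c • ((star U * X * V) * Matrix.diagonal (fun i => (hB.eigenvalues i : ℂ)) *
          (star V * V)) := by simp only [Matrix.mul_assoc, Matrix.mul_smul, Matrix.smul_mul]
      _ = _ := by rw [hVV, mul_one]
  have key' : Matrix.diagonal (fun i => (f (hA.eigenvalues i) : ℂ)) * (star U * X * V)
      = (star U * X * V) * Matrix.diagonal (fun i => (g (hB.eigenvalues i) : ℂ)) := by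
    ext i j
    have e := congrFun (congrFun key i) j
    rw [Matrix.smul_apply] at e
    simp only [Matrix.diagonal_mul, Matrix.mul_diagonal, Complex.real_smul] at e ⊢
    rcases eq_or_ne ((star U * X * V) i j) 0 with h0 | h0
    · simp [h0]
    · have e' : hA.eigenvalues i = c * hB.eigenvalues j := by
        have : (hA.eigenvalues i : ℂ) = ((c * hB.eigenvalues j : ℝ) : ℂ) := by
          apply mul_right_cancel₀ h0
          rw [e]; push_cast; ring
        exact_mod_cast this
      rw [e', hfg, mul_comm]
  rw [matFun, matFun, dif_pos hA, dif_pos hB]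
  calc _ = U * (Matrix.diagonal (fun i => (f (hA.eigenvalues i) : ℂ)) * (star U * X * V)) *
        star V := by
        simp only [Matrix.mul_assoc]; rw [hVV', mul_one]
    _ = (U * star U) * X * V * Matrix.diagonal (fun i => (g (hB.eigenvalues i) : ℂ)) *
        star V := by
        rw [key']; simp only [Matrix.mul_assoc]
    _ = _ := by rw [hUU', one_mul]; simp only [Matrix.mul_assoc]; rfl

open QRD in
theorem QRD.matFun_mul_matFun {n : Type*} [Fintype n] [DecidableEq n] {A : Matrix n n ℂ}
    (hA : A.IsHermitian) (f g : ℝ → ℝ) :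
    matFun A f * matFun A g = matFun A (fun x => f x * g x) := by
  have hUU : star (hA.eigenvectorUnitary : Matrix n n ℂ) * hA.eigenvectorUnitary = 1 :=
    Unitary.coe_star_mul_self _
  simp only [matFun, dif_pos hA, Complex.ofReal_mul]
  rw [← Matrix.diagonal_mul_diagonal]
  simp only [Matrix.mul_assoc]
  rw [← Matrix.mul_assoc (star _) (hA.eigenvectorUnitary : Matrix n n ℂ), hUU, one_mul]

open QRD in
theorem QRD.matFun_id {n : Type*} [Fintype n] [DecidableEq n] {A : Matrix n n ℂ}
    (hA : A.IsHermitian) : matFun A (fun x => x) = A := by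
  conv_rhs => rw [hA.spectral_theorem, Unitary.conjStarAlgAut_apply]
  rw [matFun, dif_pos hA]
  rfl

open QRD in
theorem QRD.matFun_isHermitian {n : Type*} [Fintype n] [DecidableEq n] (A : Matrix n n ℂ)
    (f : ℝ → ℝ) : (matFun A f).IsHermitian := by
  rw [matFun]
  split_ifs with hA
  · refine Matrix.isHermitian_mul_mul_conjTranspose _ ?_
    rw [Matrix.isHermitian_diagonal_iff]
    intro i
    simp [isSelfAdjoint_iff]
  · exact Matrix.isHermitian_zero

open QRD in
theorem QRD.supp_mul_supp {n : Type*} [Fintype n] [DecidableEq n] {A : Matrix n n ℂ}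
    (hA : A.IsHermitian) : supp A * supp A = supp A := by
  rw [supp, matFun_mul_matFun hA]
  congr 1; funext x; split_ifs <;> simp

open QRD in
theorem QRD.mul_supp {n : Type*} [Fintype n] [DecidableEq n] {A : Matrix n n ℂ}
    (hA : A.IsHermitian) : A * supp A = A := by
  have h := matFun_mul_matFun hA (fun x => x) (fun x => if x = 0 then 0 else 1)
  rw [matFun_id hA] at h
  rw [supp, h]
  conv_rhs => rw [← matFun_id hA]
  congr 1; funext x; split_ifs with h <;> simp [h]

open QRD in
theorem QRD.supp_mul {n : Type*} [Fintype n] [DecidableEq n] {A : Matrix n n ℂ}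
    (hA : A.IsHermitian) : supp A * A = A := by
  have h := congrArg Matrix.conjTranspose (mul_supp hA)
  have hs : (supp A).IsHermitian := matFun_isHermitian A _
  rwa [Matrix.conjTranspose_mul, hA.eq, hs.eq] at h

open QRD in
theorem QRD.matFun_log_mul {n : Type*} [Fintype n] [DecidableEq n] {A : Matrix n n ℂ}
    (hA : A.IsHermitian) {c : ℝ} (hc : 0 < c) :
    matFun A (fun x => Real.log (c * x)) = Real.log c • supp A + matLog A := by
  have h : (Matrix.diagonal fun i => (Real.log (c * hA.eigenvalues i) : ℂ)) =
      Real.log c • (Matrix.diagonal fun i =>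
        (((if hA.eigenvalues i = 0 then 0 else 1 : ℝ)) : ℂ)) +
      Matrix.diagonal fun i => (Real.log (hA.eigenvalues i) : ℂ) := by
    rw [← Matrix.diagonal_smul, Matrix.diagonal_add]
    congr 1; funext i
    by_cases h0 : hA.eigenvalues i = 0
    · simp [h0]
    · simp only [Real.log_mul hc.ne' h0, Pi.smul_apply, if_neg h0, Complex.real_smul]
      push_cast; ring
  simp only [supp, matLog, matFun, dif_pos hA]
  rw [h]
  simp only [Matrix.mul_add, Matrix.add_mul, Matrix.mul_smul, Matrix.smul_mul]

open QRD in
/-- If `ρ`, `σ` are density matrices on `ℂ^d` and there is `γ > 0` with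
`σ·s(ρ) = s(ρ)·σ` and `ρ = γ·σ·s(ρ)`, then `D(ρ‖σ) = log γ = D_max(ρ‖σ)`. -/
theorem relEntropy_eq_log_and_maxRelEntropy_eq_log
    {d : ℕ} (ρ σ : Matrix (Fin d) (Fin d) ℂ)
    (hρ : IsDensityMatrix ρ) (hσ : IsDensityMatrix σ)
    (γ : ℝ) (hγ : 0 < γ)
    (hcomm : σ * supp ρ = supp ρ * σ)
    (hρσ : ρ = γ • (σ * supp ρ)) :
    Drel ρ σ = ((Real.log γ : ℝ) : EReal) ∧
      Dmax ρ σ = ((Real.log γ : ℝ) : EReal) ∧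
      Drel ρ σ = Dmax ρ σ := by
  obtain ⟨hρ0, hρ1⟩ := hρ
  have hσ0 := hσ.1
  have hρh := hρ0.isHermitian
  have hσh := hσ0.isHermitian
  have hPh : (supp ρ).IsHermitian := matFun_isHermitian ρ _
  have hPP := supp_mul_supp hρh
  have hρP := mul_supp hρh
  have hPρ := supp_mul hρh
  have hρσ' : ρ = γ • (supp ρ * σ) := by rw [← hcomm]; exact hρσ
  generalize hP : supp ρ = P at *
  have hsupp : suppLE ρ σ := by
    intro v hv
    rw [LinearMap.mem_ker, Matrix.mulVecLin_apply] at hv ⊢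
    rw [hρσ', Matrix.smul_mulVec, ← Matrix.mulVec_mulVec, hv, Matrix.mulVec_zero, smul_zero]
  have hlog : matLog ρ * P = P * (Real.log γ • supp σ + matLog σ) := by
    rw [← matFun_log_mul hσh hγ]
    exact matFun_mul_eq_mul_matFun hρh hσh γ (hρP.trans hρσ') _ _ fun _ => rfl
  have hρsσ : ρ * supp σ = ρ := by
    rw [hρσ', Matrix.smul_mul, Matrix.mul_assoc, mul_supp hσh]
  have htr : (ρ * matLog ρ).trace = Real.log γ + (ρ * matLog σ).trace := by
    calc (ρ * matLog ρ).trace = (P * (ρ * matLog ρ)).trace := by rw [← Matrix.mul_assoc, hPρ]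
      _ = (ρ * (matLog ρ * P)).trace := by rw [Matrix.trace_mul_comm, Matrix.mul_assoc]
      _ = _ := by
        rw [hlog, ← Matrix.mul_assoc, hρP, Matrix.mul_add, Matrix.mul_smul, hρsσ,
          Matrix.trace_add, Matrix.trace_smul, hρ1]
        simp
  have hD : Drel ρ σ = ((Real.log γ : ℝ) : EReal) := by
    rw [Drel, if_pos hsupp, Matrix.mul_sub, Matrix.trace_sub, htr]
    simp
  have hleast : IsLeast {c : ℝ | 0 ≤ c ∧ loewnerLE ρ (c • σ)} γ := by
    constructor
    · refine ⟨hγ.le, ?_⟩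
      have h := (hσ0.mul_mul_conjTranspose_same (1 - P)).smul hγ.le
      have e : γ • σ - ρ = γ • ((1 - P) * σ * (1 - P).conjTranspose) := by
        rw [Matrix.conjTranspose_sub, Matrix.conjTranspose_one, hPh.eq, Matrix.sub_mul, one_mul,
          ← hcomm, Matrix.mul_sub, mul_one, Matrix.sub_mul, Matrix.mul_assoc, hPP]
        conv_lhs => rw [hρσ]
        rw [sub_self, sub_zero, smul_sub]
      rw [loewnerLE, e]
      exact h
    · rintro c ⟨-, hc⟩
      have h := (hc.mul_mul_conjTranspose_same P).trace_nonneg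
      have hσP : σ * P = γ⁻¹ • ρ := by
        conv_rhs => rw [hρσ]
        rw [smul_smul, inv_mul_cancel₀ hγ.ne', one_smul]
      have e : P * (c • σ - ρ) * P.conjTranspose = (c * γ⁻¹ - 1) • ρ := by
        rw [hPh.eq, Matrix.mul_sub, Matrix.mul_smul, ← hcomm, hPρ, Matrix.sub_mul,
          Matrix.smul_mul, Matrix.mul_assoc, hPP, hρP, hσP, smul_smul, sub_smul, one_smul]
      rw [e, Matrix.trace_smul, hρ1, Complex.real_smul, mul_one, Complex.zero_le_real] at h
      rwa [sub_nonneg, ← div_eq_mul_inv, one_le_div hγ] at h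
  have hM : Dmax ρ σ = ((Real.log γ : ℝ) : EReal) := by
    rw [Dmax, if_pos ⟨γ, hleast.1⟩, hleast.csInf_eq]
  exact ⟨hD, hM, hD.trans hM.symm⟩
end

section
/- Let ρ and σ be density matrices on ℂ^d with s(ρ) ≤ s(σ). Then the following conditions are equivalent: (a) the function s ↦ ψ(s) := log Q*_{s+1}(ρ‖σ) is affine on (0,+∞); (b) D(ρ‖σ) = D_max(ρ‖σ); (c) ρσ = σρ and there exists γ > 0 such that ρ = γ·σ·s(ρ); (d) σ·s(ρ) = s(ρ)·σ and there exists γ > 0 such that ρ = γ·σ·s(ρ). -/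
open scoped ENNReal ComplexOrder Classical

namespace QRD

open Matrix

section FunctionalCalculus

variable {n : Type*} [Fintype n] [DecidableEq n] {A B : Matrix n n ℂ}

lemma matFun_eq (hA : A.IsHermitian) (f : ℝ → ℝ) :
    matFun A f = (hA.eigenvectorUnitary : Matrix n n ℂ) *
      diagonal (fun i => (f (hA.eigenvalues i) : ℂ)) *
      star (hA.eigenvectorUnitary : Matrix n n ℂ) := by
  simp [matFun, hA]

lemma matFun_eq_cfc (hA : A.IsHermitian) (f : ℝ → ℝ) : matFun A f = cfc f A := by
  rw [matFun_eq hA, hA.cfc_eq, IsHermitian.cfc, Unitary.conjStarAlgAut_apply]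
  rfl

lemma continuousOn_spectrum (A : Matrix n n ℂ) (f : ℝ → ℝ) : ContinuousOn f (spectrum ℝ A) :=
  A.finite_real_spectrum.continuousOn f

lemma isHermitian_matFun (hA : A.IsHermitian) (f : ℝ → ℝ) : (matFun A f).IsHermitian := by
  rw [matFun_eq_cfc hA]
  exact cfc_predicate f A

lemma matFun_id_s3 (hA : A.IsHermitian) : matFun A (fun x => x) = A := by
  rw [matFun_eq_cfc hA]
  exact cfc_id' ℝ A hA

lemma matFun_one (hA : A.IsHermitian) : matFun A (fun _ => 1) = 1 := by
  rw [matFun_eq_cfc hA]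
  exact cfc_const_one ℝ A hA

lemma matFun_mul_matFun_s3 (hA : A.IsHermitian) (f g : ℝ → ℝ) :
    matFun A f * matFun A g = matFun A (fun x => f x * g x) := by
  simp only [matFun_eq_cfc hA]
  exact (cfc_mul f g A (continuousOn_spectrum A f) (continuousOn_spectrum A g)).symm

lemma matFun_sub (hA : A.IsHermitian) (f g : ℝ → ℝ) :
    matFun A (fun x => f x - g x) = matFun A f - matFun A g := by
  simp only [matFun_eq_cfc hA]
  exact cfc_sub f g A (continuousOn_spectrum A f) (continuousOn_spectrum A g)

lemma matFun_const_mul (hA : A.IsHermitian) (c : ℝ) (f : ℝ → ℝ) :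
    matFun A (fun x => c * f x) = c • matFun A f := by
  simp only [matFun_eq_cfc hA]
  exact cfc_const_mul c f A (continuousOn_spectrum A f)

lemma matFun_congr (hA : A.IsHermitian) {f g : ℝ → ℝ}
    (h : ∀ i, f (hA.eigenvalues i) = g (hA.eigenvalues i)) : matFun A f = matFun A g := by
  simp only [matFun_eq hA, h]

lemma matFun_matFun (hA : A.IsHermitian) (f g : ℝ → ℝ) :
    matFun (matFun A f) g = matFun A (fun x => g (f x)) := by
  rw [matFun_eq_cfc (isHermitian_matFun hA f), matFun_eq_cfc hA, matFun_eq_cfc hA]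
  exact (cfc_comp' g f A ((A.finite_real_spectrum.image f).continuousOn g)
    (continuousOn_spectrum A f) hA).symm

lemma trace_matFun (hA : A.IsHermitian) (f : ℝ → ℝ) :
    (matFun A f).trace = ∑ i, (f (hA.eigenvalues i) : ℂ) := by
  rw [matFun_eq hA, trace_mul_cycle, Unitary.coe_star_mul_self, one_mul, trace_diagonal]

lemma posSemidef_matFun (hA : A.IsHermitian) {f : ℝ → ℝ} (hf : ∀ i, 0 ≤ f (hA.eigenvalues i)) :
    (matFun A f).PosSemidef := by
  rw [matFun_eq hA]
  exact (PosSemidef.diagonal (d := fun i => (f (hA.eigenvalues i) : ℂ))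
    fun i => by simpa using hf i).mul_mul_conjTranspose_same _

/-- The matrix of inner products of the eigenvectors of `A` with those of `B`. -/
noncomputable def overlap (hA : A.IsHermitian) (hB : B.IsHermitian) : Matrix n n ℂ :=
  star (hA.eigenvectorUnitary : Matrix n n ℂ) * (hB.eigenvectorUnitary : Matrix n n ℂ)

lemma matFun_mul_matFun_eq (hA : A.IsHermitian) (hB : B.IsHermitian) (f g : ℝ → ℝ) :
    matFun A f * matFun B g = (hA.eigenvectorUnitary : Matrix n n ℂ) *
      of (fun i j => (f (hA.eigenvalues i) * g (hB.eigenvalues j) : ℂ) * overlap hA hB i j) *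
      star (hB.eigenvectorUnitary : Matrix n n ℂ) := by
  have : of (fun i j => (f (hA.eigenvalues i) * g (hB.eigenvalues j) : ℂ) * overlap hA hB i j) =
      diagonal (fun i => (f (hA.eigenvalues i) : ℂ)) * overlap hA hB *
        diagonal (fun i => (g (hB.eigenvalues i) : ℂ)) := by
    ext i j
    simp only [of_apply, mul_diagonal, diagonal_mul]
    ring
  rw [this, matFun_eq hA, matFun_eq hB, overlap]
  simp only [Matrix.mul_assoc]

lemma matFun_mul_matFun_eq_iff (hA : A.IsHermitian) (hB : B.IsHermitian) (f g h k : ℝ → ℝ) :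
    matFun A f * matFun B g = matFun A h * matFun B k ↔ ∀ i j, overlap hA hB i j ≠ 0 →
      f (hA.eigenvalues i) * g (hB.eigenvalues j) =
        h (hA.eigenvalues i) * k (hB.eigenvalues j) := by
  rw [matFun_mul_matFun_eq hA hB, matFun_mul_matFun_eq hA hB]
  constructor
  · intro H i j hij
    replace H := congr(star (hA.eigenvectorUnitary : Matrix n n ℂ) * $H *
      (hB.eigenvectorUnitary : Matrix n n ℂ))
    simp only [Matrix.mul_assoc, Unitary.coe_star_mul_self, Matrix.mul_one] at H
    simp only [← Matrix.mul_assoc, Unitary.coe_star_mul_self, Matrix.one_mul] at H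
    have := congrFun₂ H i j
    simp only [of_apply] at this
    exact_mod_cast mul_right_cancel₀ hij this
  · intro H
    congr 2
    ext i j
    by_cases hij : overlap hA hB i j = 0
    · simp [hij]
    · simp only [of_apply]
      congr 1
      exact_mod_cast H i j hij

lemma trace_matFun_mul_matFun (hA : A.IsHermitian) (hB : B.IsHermitian) (f g : ℝ → ℝ) :
    (matFun A f * matFun B g).trace = ((∑ i, ∑ j, f (hA.eigenvalues i) * g (hB.eigenvalues j) *
      Complex.normSq (overlap hA hB i j) : ℝ) : ℂ) := by
  rw [matFun_mul_matFun_eq hA hB, trace_mul_cycle]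
  have : star (hB.eigenvectorUnitary : Matrix n n ℂ) * (hA.eigenvectorUnitary : Matrix n n ℂ) =
      (overlap hA hB)ᴴ := by
    simp [overlap, star_eq_conjTranspose, conjTranspose_mul]
  rw [this, trace_mul_comm]
  simp only [trace, diag_apply, mul_apply, of_apply, conjTranspose_apply, mul_assoc,
    RCLike.star_def, Complex.mul_conj]
  push_cast
  rfl

lemma eigenvalues_le_of_trace (hA : A.PosSemidef) (i : n) :
    hA.1.eigenvalues i ≤ A.trace.re := by
  rw [hA.1.trace_eq_sum_eigenvalues]
  simpa using Finset.single_le_sum (f := hA.1.eigenvalues)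
    (fun j _ => hA.eigenvalues_nonneg j) (Finset.mem_univ i)

lemma suppLE_iff_mul_supp (hB : B.IsHermitian) :
    suppLE A B ↔ A * supp B = A := by
  have hBs : B * supp B = B := by
    conv_lhs => rw [← matFun_id_s3 hB, supp, matFun_id_s3 hB]
    conv_lhs => enter [1]; rw [← matFun_id_s3 hB]
    rw [matFun_mul_matFun_s3 hB]
    conv_rhs => rw [← matFun_id_s3 hB]
    exact matFun_congr hB fun i => by split_ifs with h <;> simp [h]
  constructor
  · intro h
    have key : A * (1 - supp B) = 0 := by
      ext i j
      have h1 : (1 - supp B).col j ∈ LinearMap.ker B.mulVecLin := by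
        rw [LinearMap.mem_ker, mulVecLin_apply, ← mulVec_single_one, mulVec_mulVec, Matrix.mul_sub,
          hBs, Matrix.mul_one, sub_self, mulVec_single_one]
        rfl
      have h2 := h h1
      rw [LinearMap.mem_ker, mulVecLin_apply, ← mulVec_single_one, mulVec_mulVec,
        mulVec_single_one] at h2
      exact congrFun h2 i
    rw [Matrix.mul_sub, Matrix.mul_one, sub_eq_zero] at key
    exact key.symm
  · intro h v hv
    have hsB : supp B = matFun B (fun x => x⁻¹) * B := by
      conv_rhs => enter [2]; rw [← matFun_id_s3 hB]
      rw [matFun_mul_matFun_s3 hB]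
      exact matFun_congr hB fun i => by split_ifs with h <;> simp [h]
    rw [LinearMap.mem_ker, mulVecLin_apply] at hv ⊢
    rw [← h, hsB, ← mulVec_mulVec, ← mulVec_mulVec, hv, mulVec_zero, mulVec_zero]

end FunctionalCalculus

section Loewner

variable {n : Type*} [Fintype n] {ρ σ : Matrix n n ℂ} {γ : ℝ}

lemma isClosed_setOf_loewnerLE (ρ σ : Matrix n n ℂ) :
    IsClosed {γ : ℝ | 0 ≤ γ ∧ loewnerLE ρ (γ • σ)} := by
  simp only [loewnerLE, posSemidef_iff_dotProduct_mulVec, IsHermitian, Set.ofPred_and,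
    Set.ofPred_forall]
  refine isClosed_Ici.inter ((isClosed_eq (by fun_prop) (by fun_prop)).inter ?_)
  refine isClosed_iInter fun x => isClosed_le continuous_const ?_
  fun_prop

lemma one_le_of_loewnerLE (hρ : ρ.trace = 1) (hσ : σ.trace = 1) (h : loewnerLE ρ (γ • σ)) :
    1 ≤ γ := by
  have := h.trace_nonneg
  rw [trace_sub, trace_smul, hρ, hσ, Complex.nonneg_iff] at this
  simpa using this.1

lemma conj_smul_sub_eq {τ U P : Matrix n n ℂ} (hτ : τᴴ = τ) (hτσ : τ * σ * τ = τ)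
    (hρ : ρ = U * P * Uᴴ) (γ : ℝ) :
    (τ * U)ᴴ * (γ • σ - ρ) * (τ * U) =
      γ • (Uᴴ * τ * U) - Uᴴ * τ * U * P * (Uᴴ * τ * U)ᴴ := by
  rw [conjTranspose_mul, hτ, Matrix.mul_sub, Matrix.sub_mul]
  congr 1
  · conv_rhs => rw [← hτσ]
    simp only [Matrix.mul_smul, smul_mul, Matrix.mul_assoc]
  · rw [hρ]
    simp only [conjTranspose_mul, conjTranspose_conjTranspose, hτ, Matrix.mul_assoc]

end Loewner

section States

variable {n : Type*} [Fintype n] [DecidableEq n] {ρ σ : Matrix n n ℂ} {γ : ℝ}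

lemma matFun_mul_matFun_one (ρ : Matrix n n ℂ) (hσ : σ.IsHermitian) (f : ℝ → ℝ) :
    matFun ρ f * matFun σ (fun _ => 1) = matFun ρ f := by
  rw [matFun_one hσ, Matrix.mul_one]

lemma supp_mul_supp_s3 (hρ : ρ.IsHermitian) : supp ρ * supp ρ = supp ρ := by
  rw [supp, matFun_mul_matFun_s3 hρ]
  exact matFun_congr hρ fun i => by split_ifs <;> simp

lemma isHermitian_supp (hρ : ρ.IsHermitian) : (supp ρ).IsHermitian :=
  isHermitian_matFun hρ _

lemma mul_supp_self (hρ : ρ.IsHermitian) : ρ * supp ρ = ρ :=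
  (suppLE_iff_mul_supp hρ).1 le_rfl

lemma eq_smul_mul_supp_iff (hρ : ρ.IsHermitian) (hσ : σ.IsHermitian) :
    ρ = γ • (σ * supp ρ) ↔ ∀ i j, overlap hρ hσ i j ≠ 0 → hρ.eigenvalues i ≠ 0 →
      hρ.eigenvalues i = γ * hσ.eigenvalues j := by
  have h1 : ρ = γ • (σ * supp ρ) ↔
      matFun ρ (fun x => x) * matFun σ (fun _ => 1) =
        matFun ρ (fun x => γ * if x = 0 then 0 else 1) * matFun σ (fun x => x) := by
    rw [matFun_mul_matFun_one ρ hσ, matFun_id_s3 hρ, matFun_id_s3 hσ, matFun_const_mul hρ, ← supp,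
      ← conjTranspose_inj, hρ.eq, conjTranspose_smul, conjTranspose_mul, hσ.eq,
      (isHermitian_supp hρ).eq, smul_mul, star_trivial]
  rw [h1, matFun_mul_matFun_eq_iff hρ hσ]
  refine forall₂_congr fun i j => forall_congr' fun _ => ?_
  by_cases hi : hρ.eigenvalues i = 0 <;> simp [hi]

lemma eigenvalues_ne_zero_of_suppLE (hρ : ρ.IsHermitian) (hσ : σ.IsHermitian) (h : suppLE ρ σ)
    {i j : n} (hij : overlap hρ hσ i j ≠ 0) (hi : hρ.eigenvalues i ≠ 0) :
    hσ.eigenvalues j ≠ 0 := by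
  rw [suppLE_iff_mul_supp hσ] at h
  have h1 : matFun ρ (fun x => x) * matFun σ (fun x => if x = 0 then 0 else 1) =
      matFun ρ (fun x => x) * matFun σ (fun _ => 1) := by
    rw [matFun_mul_matFun_one ρ hσ, matFun_id_s3 hρ]
    exact h
  have h2 := (matFun_mul_matFun_eq_iff hρ hσ _ _ _ _).1 h1 i j hij
  intro hj
  simp [hj] at h2
  exact hi h2.symm

lemma sum_eigenvalues_mul_normSq_overlap (hρ : ρ.IsHermitian) (hσ : σ.IsHermitian) :
    ∑ i, ∑ j, hρ.eigenvalues i * Complex.normSq (overlap hρ hσ i j) = ρ.trace.re := by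
  have := trace_matFun_mul_matFun hρ hσ (fun x => x) (fun _ => 1)
  rw [matFun_mul_matFun_one ρ hσ, matFun_id_s3 hρ] at this
  rw [this, Complex.ofReal_re]
  simp

lemma mul_supp_comm_of_eq_smul (hρ : ρ.IsHermitian) (hσ : σ.IsHermitian) (hγ : 0 < γ)
    (h : ρ = γ • (σ * supp ρ)) : σ * supp ρ = supp ρ * σ := by
  have h2 : ρ = γ • (supp ρ * σ) := by
    have := congrArg conjTranspose h
    rwa [hρ.eq, conjTranspose_smul, conjTranspose_mul, hσ.eq, (isHermitian_supp hρ).eq,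
      star_trivial] at this
  exact smul_right_injective _ hγ.ne' (h.symm.trans h2)

lemma mul_comm_of_eq_smul (hρ : ρ.IsHermitian) (hσ : σ.IsHermitian) (hγ : 0 < γ)
    (h : ρ = γ • (σ * supp ρ)) : ρ * σ = σ * ρ := by
  have hc := mul_supp_comm_of_eq_smul hρ hσ hγ h
  generalize supp ρ = s at *
  rw [h, smul_mul, Matrix.mul_assoc, ← hc, Matrix.mul_smul]

lemma isHermitian_matPow (hσ : σ.IsHermitian) (t : ℝ) : (matPow σ t).IsHermitian :=
  isHermitian_matFun hσ _

lemma Qstar_of_suppLE (h : suppLE ρ σ) (α : ℝ) : Qstar α ρ σ = ENNReal.ofReal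
    ((matPow (matPow σ ((1 - α) / (2 * α)) * ρ * matPow σ ((1 - α) / (2 * α))) α).trace.re) := by
  simp [Qstar, h]

lemma Qstar_of_eq_smul (hρ : IsDensityMatrix ρ) (hσ : σ.IsHermitian) (hs : suppLE ρ σ)
    (hγ : 0 < γ) (h : ρ = γ • (σ * supp ρ)) {α : ℝ} (hα : 0 < α) :
    Qstar α ρ σ = ENNReal.ofReal (γ ^ (α - 1)) := by
  obtain ⟨hρ, htr⟩ := hρ
  rw [eq_smul_mul_supp_iff hρ.1 hσ] at h
  rw [Qstar_of_suppLE hs]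
  set t := (1 - α) / (2 * α) with ht
  have hq : ∀ i j, overlap hρ.1 hσ i j ≠ 0 → hρ.1.eigenvalues i ≠ 0 →
      hσ.eigenvalues j ≠ 0 ∧ hσ.eigenvalues j = hρ.1.eigenvalues i / γ := fun i j hij hi =>
    ⟨eigenvalues_ne_zero_of_suppLE hρ.1 hσ hs hij hi, by rw [h i j hij hi]; field_simp⟩
  have h1 : ρ * matPow σ t = matFun ρ (fun x => x * (x / γ) ^ t) := by
    rw [← matFun_mul_matFun_one ρ hσ, matPow]
    conv_lhs => enter [1]; rw [← matFun_id_s3 hρ.1]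
    rw [matFun_mul_matFun_eq_iff hρ.1 hσ]
    intro i j hij
    by_cases hi : hρ.1.eigenvalues i = 0
    · simp [hi]
    · obtain ⟨h0, h1⟩ := hq i j hij hi
      rw [if_neg h0, h1, mul_one]
  have h2 : matPow σ t * ρ = matFun ρ (fun x => x * (x / γ) ^ t) := by
    have := congrArg conjTranspose h1
    rwa [conjTranspose_mul, hρ.1.eq, (isHermitian_matPow hσ t).eq,
      (isHermitian_matFun hρ.1 _).eq] at this
  have h3 : matPow σ t * ρ * matPow σ t = matFun ρ (fun x => x * (x / γ) ^ t * (x / γ) ^ t) := by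
    rw [← matFun_mul_matFun_one ρ hσ, h2, matPow, matFun_mul_matFun_eq_iff hρ.1 hσ]
    intro i j hij
    by_cases hi : hρ.1.eigenvalues i = 0
    · simp [hi]
    · obtain ⟨h0, h1⟩ := hq i j hij hi
      rw [if_neg h0, h1, mul_one]
  have h4 : matPow (matPow σ t * ρ * matPow σ t) α = γ ^ (α - 1) • ρ := by
    rw [h3, matPow, matFun_matFun hρ.1]
    conv_rhs => rw [← matFun_id_s3 hρ.1, ← matFun_const_mul hρ.1]
    refine matFun_congr hρ.1 fun i => ?_
    rcases (hρ.eigenvalues_nonneg i).eq_or_lt with hi | hi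
    · simp [← hi]
    · have hx := div_pos hi hγ
      rw [if_neg (by positivity), mul_assoc, ← Real.rpow_add hx, Real.mul_rpow hi.le (by positivity),
        ← Real.rpow_mul hx.le]
      have : (t + t) * α = 1 - α := by rw [ht]; field_simp; ring
      rw [this, Real.div_rpow hi.le hγ.le, ← neg_sub α 1, Real.rpow_neg hγ.le, Real.rpow_neg hi.le,
        div_inv_eq_mul]
      have h5 : hρ.1.eigenvalues i ^ α = hρ.1.eigenvalues i * hρ.1.eigenvalues i ^ (α - 1) := by
        rw [Real.rpow_sub_one hi.ne']; field_simp
      rw [h5]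
      have := (Real.rpow_pos_of_pos hi (α - 1)).ne'
      field_simp
  rw [h4, trace_smul, htr]
  simp

lemma Drel_eq_sum (hρ : ρ.IsHermitian) (hσ : σ.IsHermitian) (h : suppLE ρ σ) :
    Drel ρ σ = ((∑ i, ∑ j, hρ.eigenvalues i * Complex.normSq (overlap hρ hσ i j) *
      (Real.log (hρ.eigenvalues i) - Real.log (hσ.eigenvalues j)) : ℝ) : EReal) := by
  rw [Drel, if_pos h]
  congr 1
  have h1 := trace_matFun_mul_matFun hρ hσ (fun x => x * Real.log x) (fun _ => 1)
  have h2 := trace_matFun_mul_matFun hρ hσ (fun x => x) Real.log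
  rw [matFun_mul_matFun_one ρ hσ, ← matFun_mul_matFun_s3 hρ] at h1
  rw [matFun_id_s3 hρ] at h1 h2
  rw [Matrix.mul_sub, trace_sub, matLog, matLog, h1, h2, ← Complex.ofReal_sub, Complex.ofReal_re,
    ← Finset.sum_sub_distrib]
  refine Finset.sum_congr rfl fun i _ => ?_
  rw [← Finset.sum_sub_distrib]
  exact Finset.sum_congr rfl fun j _ => by ring

lemma exists_loewnerLE (hρ : IsDensityMatrix ρ) (hσ : σ.PosSemidef) (hs : suppLE ρ σ) :
    ∃ γ : ℝ, 0 ≤ γ ∧ loewnerLE ρ (γ • σ) := by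
  have hinv : ∀ j, 0 ≤ (hσ.1.eigenvalues j)⁻¹ := fun j => inv_nonneg.2 (hσ.eigenvalues_nonneg j)
  refine ⟨∑ j, (hσ.1.eigenvalues j)⁻¹, Finset.sum_nonneg fun j _ => hinv j, ?_⟩
  set K := ∑ j, (hσ.1.eigenvalues j)⁻¹
  have h1 : (1 - ρ).PosSemidef := by
    have := posSemidef_matFun hρ.1.1 (f := fun x => 1 - x) fun i => by
      simpa [hρ.2] using eigenvalues_le_of_trace hρ.1 i
    rwa [matFun_sub hρ.1.1, matFun_one hρ.1.1, matFun_id_s3 hρ.1.1] at this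
  have h2 : (K • σ - supp σ).PosSemidef := by
    have := posSemidef_matFun hσ.1 (f := fun x => K * x - if x = 0 then 0 else 1) fun i => by
      split_ifs with h
      · simp [h]
      · rw [sub_nonneg, ← inv_mul_cancel₀ h]
        exact mul_le_mul_of_nonneg_right (Finset.single_le_sum (f := fun j => (hσ.1.eigenvalues j)⁻¹)
          (fun j _ => hinv j) (Finset.mem_univ i)) (hσ.eigenvalues_nonneg i)
    rwa [matFun_sub hσ.1, matFun_const_mul hσ.1, matFun_id_s3 hσ.1] at this
  have h3 := h1.conjTranspose_mul_mul_same (supp σ)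
  have hr := (suppLE_iff_mul_supp hσ.1).1 hs
  have hl : supp σ * ρ = ρ := by
    have := congrArg conjTranspose hr
    rwa [conjTranspose_mul, hρ.1.1.eq, (isHermitian_supp hσ.1).eq] at this
  rw [(isHermitian_supp hσ.1).eq, Matrix.mul_sub, Matrix.sub_mul, Matrix.mul_one,
    supp_mul_supp_s3 hσ.1, hl, hr] at h3
  simpa [loewnerLE] using h2.add h3

lemma loewnerLE_of_eq_smul (hρ : ρ.IsHermitian) (hσ : σ.PosSemidef)
    (hγ : 0 < γ) (h : ρ = γ • (σ * supp ρ)) : loewnerLE ρ (γ • σ) := by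
  have hc := mul_supp_comm_of_eq_smul hρ hσ.1 hγ h
  have hH := isHermitian_supp hρ
  have hss := supp_mul_supp_s3 hρ
  have key := (hσ.conjTranspose_mul_mul_same (1 - supp ρ)).smul hγ.le
  rw [loewnerLE]
  convert key using 1
  rw [conjTranspose_sub, conjTranspose_one, hH.eq]
  conv_lhs => rw [h]
  rw [← smul_sub]
  congr 1
  rw [Matrix.sub_mul, ← hc, Matrix.one_mul, Matrix.mul_sub, Matrix.mul_one, Matrix.sub_mul,
    Matrix.mul_assoc, hss]
  simp

lemma le_of_loewnerLE_of_eq_smul (hρ : IsDensityMatrix ρ) (hγ : 0 < γ)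
    (h : ρ = γ • (σ * supp ρ)) {c : ℝ} (hc : loewnerLE ρ (c • σ)) : γ ≤ c := by
  have hH := isHermitian_supp hρ.1.1
  have hss := supp_mul_supp_s3 hρ.1.1
  have key := (hc.conjTranspose_mul_mul_same (supp ρ)).trace_nonneg
  have htr : (σ * supp ρ).trace = (γ⁻¹ : ℝ) := by
    have := congrArg trace h
    rw [hρ.2, trace_smul] at this
    have hγ' : (γ : ℂ) ≠ 0 := by exact_mod_cast hγ.ne'
    push_cast
    rw [Complex.real_smul] at this
    field_simp
    rw [mul_comm]
    exact this.symm
  rw [hH.eq, Matrix.mul_assoc, trace_mul_comm, Matrix.mul_assoc, hss, Matrix.sub_mul,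
    mul_supp_self hρ.1.1, smul_mul, trace_sub, trace_smul, htr, hρ.2, Complex.nonneg_iff] at key
  have := key.1
  simp [← div_eq_mul_inv] at this
  exact (one_le_div hγ).1 this

lemma Drel_eq_Dmax_of_eq_smul (hρ : IsDensityMatrix ρ) (hσ : σ.PosSemidef) (hs : suppLE ρ σ)
    (hγ : 0 < γ) (h : ρ = γ • (σ * supp ρ)) : Drel ρ σ = Dmax ρ σ := by
  have hle := loewnerLE_of_eq_smul hρ.1.1 hσ hγ h
  have hleast : IsLeast {c : ℝ | 0 ≤ c ∧ loewnerLE ρ (c • σ)} γ :=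
    ⟨⟨hγ.le, hle⟩, fun c hc => le_of_loewnerLE_of_eq_smul hρ hγ h hc.2⟩
  rw [Dmax, if_pos ⟨γ, hγ.le, hle⟩, hleast.csInf_eq, Drel_eq_sum hρ.1.1 hσ.1 hs]
  rw [eq_smul_mul_supp_iff hρ.1.1 hσ.1] at h
  congr 1
  have := (sum_eigenvalues_mul_normSq_overlap hρ.1.1 hσ.1).trans (congrArg Complex.re hρ.2)
  rw [Complex.one_re] at this
  rw [← one_mul (Real.log γ), ← this, Finset.sum_mul]
  refine Finset.sum_congr rfl fun i _ => ?_
  rw [Finset.sum_mul]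
  refine Finset.sum_congr rfl fun j _ => ?_
  by_cases hij : overlap hρ.1.1 hσ.1 i j = 0
  · simp [hij]
  by_cases hi : hρ.1.1.eigenvalues i = 0
  · simp [hi]
  rw [h i j hij hi, Real.log_mul hγ.ne' (eigenvalues_ne_zero_of_suppLE hρ.1.1 hσ.1 hs hij hi)]
  ring

lemma mul_star_eq (z : ℂ) : z * star z = Complex.normSq z :=
  Complex.mul_conj z

lemma eigenvalues_mul_sum_inv_le (hρ : ρ.PosSemidef) (hσ : σ.PosSemidef) (hγ : 0 ≤ γ)
    (h : loewnerLE ρ (γ • σ)) (i : n) :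
    hρ.1.eigenvalues i * ∑ j, (hσ.1.eigenvalues j)⁻¹ * Complex.normSq (overlap hρ.1 hσ.1 i j)
      ≤ γ := by
  set U := (hρ.1.eigenvectorUnitary : Matrix n n ℂ) with hU
  set p := hρ.1.eigenvalues
  set τ := matFun σ (fun x => x⁻¹)
  set t := ∑ j, (hσ.1.eigenvalues j)⁻¹ * Complex.normSq (overlap hρ.1 hσ.1 i j)
  set G := Uᴴ * τ * U
  have hτ : τᴴ = τ := isHermitian_matFun hσ.1 _
  have hGi : G i i = (t : ℂ) := by
    have : G = overlap hρ.1 hσ.1 * diagonal (fun j => (((hσ.1.eigenvalues j)⁻¹ : ℝ) : ℂ)) *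
        (overlap hρ.1 hσ.1)ᴴ := by
      simp only [G, τ, matFun_eq hσ.1, overlap, conjTranspose_mul, star_eq_conjTranspose,
        conjTranspose_conjTranspose, Matrix.mul_assoc, hU]
    rw [this, mul_apply]
    simp only [mul_diagonal, conjTranspose_apply, t]
    push_cast
    refine Finset.sum_congr rfl fun j _ => ?_
    rw [mul_right_comm, mul_star_eq, mul_comm]
  have hτστ : τ * σ * τ = τ := by
    conv_lhs => enter [1, 2]; rw [← matFun_id_s3 hσ.1]
    rw [matFun_mul_matFun_s3 hσ.1, matFun_mul_matFun_s3 hσ.1]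
    refine matFun_congr hσ.1 fun j => ?_
    by_cases hj : hσ.1.eigenvalues j = 0 <;> simp [hj]
  have hρU : ρ = U * diagonal (fun k => (p k : ℂ)) * Uᴴ := by
    conv_lhs => rw [← matFun_id_s3 hρ.1, matFun_eq hρ.1, star_eq_conjTranspose]
  have key := (h.conjTranspose_mul_mul_same (τ * U)).diag_nonneg (i := i)
  have e : (τ * U)ᴴ * (γ • σ - ρ) * (τ * U) =
      γ • G - G * diagonal (fun k => (p k : ℂ)) * Gᴴ :=
    conj_smul_sub_eq hτ hτστ hρU γ
  rw [e, Matrix.sub_apply, Matrix.smul_apply, hGi, mul_apply] at key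
  simp only [mul_diagonal, conjTranspose_apply] at key
  have key' : ∑ k, Complex.normSq (G i k) * p k ≤ γ * t := by
    have := (Complex.nonneg_iff.1 key).1
    simp only [Complex.sub_re, Complex.real_smul, Complex.re_ofReal_mul, Complex.ofReal_re,
      Complex.re_sum, sub_nonneg] at this
    refine le_of_eq_of_le (Finset.sum_congr rfl fun k _ => ?_) this
    rw [mul_right_comm, mul_star_eq, ← Complex.ofReal_mul, Complex.ofReal_re]
  have hle : t * t * p i ≤ ∑ k, Complex.normSq (G i k) * p k := by
    have := Finset.single_le_sum (f := fun k => Complex.normSq (G i k) * p k)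
      (fun k _ => mul_nonneg (Complex.normSq_nonneg _) (hρ.eigenvalues_nonneg k))
      (Finset.mem_univ i)
    simpa [hGi, Complex.normSq_ofReal] using this
  have ht : 0 ≤ t := Finset.sum_nonneg fun j _ =>
    mul_nonneg (inv_nonneg.2 (hσ.eigenvalues_nonneg j)) (Complex.normSq_nonneg _)
  rcases ht.eq_or_lt with h0 | h0
  · simpa [← h0] using hγ
  · refine le_of_mul_le_mul_right ?_ h0
    linarith

lemma log_le_log_add_div_sub_one {x γ : ℝ} (hx : 0 < x) (hγ : 0 < γ) :
    Real.log x ≤ Real.log γ + (x / γ - 1) := by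
  have := Real.log_le_sub_one_of_pos (div_pos hx hγ)
  rw [Real.log_div hx.ne' hγ.ne'] at this
  linarith

lemma eq_of_log_eq_log_add_div_sub_one {x γ : ℝ} (hx : 0 < x) (hγ : 0 < γ)
    (h : Real.log x = Real.log γ + (x / γ - 1)) : x = γ := by
  by_contra hne
  have := Real.log_lt_sub_one_of_pos (div_pos hx hγ) (by rwa [Ne, div_eq_one_iff_eq hγ.ne'])
  rw [Real.log_div hx.ne' hγ.ne'] at this
  linarith

lemma exists_eq_smul_of_Drel_eq_Dmax (hρ : IsDensityMatrix ρ) (hσ : IsDensityMatrix σ)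
    (hs : suppLE ρ σ) (h : Drel ρ σ = Dmax ρ σ) :
    ∃ γ : ℝ, 0 < γ ∧ ρ = γ • (σ * supp ρ) := by
  have hex := exists_loewnerLE hρ hσ.1 hs
  obtain ⟨hγ0, hle⟩ := (isClosed_setOf_loewnerLE ρ σ).csInf_mem hex ⟨0, fun c hc => hc.1⟩
  rw [Dmax, if_pos hex, Drel_eq_sum hρ.1.1 hσ.1.1 hs, EReal.coe_eq_coe_iff] at h
  set γ := sInf {γ : ℝ | 0 ≤ γ ∧ loewnerLE ρ (γ • σ)}
  have hγ : 0 < γ := one_pos.trans_le (one_le_of_loewnerLE hρ.2 hσ.2 hle)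
  refine ⟨γ, hγ, ?_⟩
  rw [eq_smul_mul_supp_iff hρ.1.1 hσ.1.1]
  have hp := hρ.1.eigenvalues_nonneg
  have hq := hσ.1.eigenvalues_nonneg
  have hsupp := fun i j => eigenvalues_ne_zero_of_suppLE hρ.1.1 hσ.1.1 hs (i := i) (j := j)
  have hone := (sum_eigenvalues_mul_normSq_overlap hρ.1.1 hσ.1.1).trans (congrArg Complex.re hρ.2)
  have hinv := eigenvalues_mul_sum_inv_le hρ.1 hσ.1 hγ0 hle
  have hsum : ∑ i, hρ.1.1.eigenvalues i = 1 := by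
    have := hρ.1.1.trace_eq_sum_eigenvalues.symm.trans hρ.2
    simpa using congrArg Complex.re this
  rw [Complex.one_re] at hone
  have hw : ∀ i j, 0 ≤ Complex.normSq (overlap hρ.1.1 hσ.1.1 i j) :=
    fun i j => Complex.normSq_nonneg _
  have hw0 : ∀ i j, Complex.normSq (overlap hρ.1.1 hσ.1.1 i j) ≠ 0 ↔
    overlap hρ.1.1 hσ.1.1 i j ≠ 0 := fun i j => by simp
  generalize hρ.1.1.eigenvalues = p at *
  generalize hσ.1.1.eigenvalues = q at *
  set w : n → n → ℝ := fun i j => Complex.normSq (overlap hρ.1.1 hσ.1.1 i j)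
  have hterm : ∀ x ∈ (Finset.univ : Finset (n × n)),
      p x.1 * w x.1 x.2 * (Real.log (p x.1) - Real.log (q x.2)) ≤
        p x.1 * w x.1 x.2 * (Real.log γ + (p x.1 / q x.2 / γ - 1)) := by
    rintro ⟨i, j⟩ -
    by_cases hij : overlap hρ.1.1 hσ.1.1 i j = 0
    · simp [w, hij]
    rcases (hp i).eq_or_lt with hi | hi
    · simp [← hi]
    have hj := (hq j).lt_of_ne' (hsupp i j hij hi.ne')
    refine mul_le_mul_of_nonneg_left ?_ (mul_nonneg hi.le (hw i j))
    rw [← Real.log_div hi.ne' hj.ne']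
    exact log_le_log_add_div_sub_one (div_pos hi hj) hγ
  have hupper : ∑ x : n × n, p x.1 * w x.1 x.2 * (Real.log γ + (p x.1 / q x.2 / γ - 1)) ≤
      Real.log γ := by
    have e1 : ∑ x : n × n, p x.1 * w x.1 x.2 * (Real.log γ + (p x.1 / q x.2 / γ - 1)) =
        (∑ i, ∑ j, p i * w i j) * (Real.log γ - 1) +
          (∑ i, p i * (p i * ∑ j, (q j)⁻¹ * w i j)) / γ := by
      rw [Fintype.sum_prod_type, Finset.sum_mul, Finset.sum_div, ← Finset.sum_add_distrib]
      refine Finset.sum_congr rfl fun i _ => ?_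
      rw [Finset.sum_mul, Finset.mul_sum, Finset.mul_sum, Finset.sum_div, ← Finset.sum_add_distrib]
      refine Finset.sum_congr rfl fun j _ => ?_
      field_simp
      ring
    have e2 : (∑ i, p i * (p i * ∑ j, (q j)⁻¹ * w i j)) ≤ γ := by
      calc _ ≤ ∑ i, p i * γ :=
            Finset.sum_le_sum fun i _ => mul_le_mul_of_nonneg_left (hinv i) (hp i)
        _ = γ := by rw [← Finset.sum_mul, hsum, one_mul]
    rw [e1, hone, one_mul]
    have := (div_le_one hγ).2 e2
    linarith
  have hlower : ∑ x : n × n, p x.1 * w x.1 x.2 * (Real.log (p x.1) - Real.log (q x.2)) =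
      Real.log γ := by
    rw [Fintype.sum_prod_type]
    exact h
  have heq := (Finset.sum_eq_sum_iff_of_le hterm).1
    (le_antisymm (Finset.sum_le_sum hterm) (hupper.trans hlower.ge))
  intro i j hij hi
  have hi' := (hp i).lt_of_ne' hi
  have hj := (hq j).lt_of_ne' (hsupp i j hij hi)
  have := mul_left_cancel₀ (mul_ne_zero hi ((hw0 i j).2 hij)) (heq (i, j) (Finset.mem_univ _))
  rw [← Real.log_div hi hj.ne'] at this
  rw [← eq_of_log_eq_log_add_div_sub_one (div_pos hi' hj) hγ this, div_mul_cancel₀ _ hj.ne']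

end States

section Renyi

variable {n : Type*} [Fintype n] [DecidableEq n] {A ρ σ : Matrix n n ℂ} {γ : ℝ}

lemma matPow_mul_matPow (hσ : σ.PosSemidef) (s t : ℝ) :
    matPow σ s * matPow σ t = matPow σ (s + t) := by
  rw [matPow, matPow, matFun_mul_matFun_s3 hσ.1]
  refine matFun_congr hσ.1 fun i => ?_
  rcases (hσ.eigenvalues_nonneg i).eq_or_lt with hi | hi
  · simp [← hi]
  · simp [hi.ne', Real.rpow_add hi]

lemma matPow_zero (σ : Matrix n n ℂ) : matPow σ 0 = supp σ := by
  simp [matPow, supp]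

lemma matPow_one (hσ : σ.IsHermitian) : matPow σ 1 = σ := by
  conv_rhs => rw [← matFun_id_s3 hσ]
  exact matFun_congr hσ fun i => by split_ifs with h <;> simp [h]

lemma trace_matPow (hA : A.PosSemidef) {α : ℝ} (hα : 0 < α) :
    (matPow A α).trace.re = ∑ i, hA.1.eigenvalues i ^ α := by
  rw [matPow, trace_matFun hA.1, ← Complex.ofReal_sum, Complex.ofReal_re]
  refine Finset.sum_congr rfl fun i _ => ?_
  split_ifs with h
  · rw [h, Real.zero_rpow hα.ne']
  · rfl

lemma posSemidef_sandwich (hρ : ρ.PosSemidef) (hσ : σ.IsHermitian) (t : ℝ) :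
    (matPow σ t * ρ * matPow σ t).PosSemidef := by
  have := hρ.conjTranspose_mul_mul_same (matPow σ t)
  rwa [(isHermitian_matPow hσ t).eq] at this

lemma one_le_trace_sandwich (hρ : IsDensityMatrix ρ) (hσ : IsDensityMatrix σ)
    (hs : suppLE ρ σ) {t : ℝ} (ht : t ≤ 0) :
    1 ≤ (matPow σ t * ρ * matPow σ t).trace.re := by
  have h1 := (sum_eigenvalues_mul_normSq_overlap hρ.1.1 hσ.1.1).trans (congrArg Complex.re hρ.2)
  have h2 := trace_matFun_mul_matFun hρ.1.1 hσ.1.1 (fun x => x)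
    (fun x => if x = 0 then 0 else x ^ (t + t))
  rw [matFun_id_s3 hρ.1.1, ← matPow] at h2
  rw [Matrix.mul_assoc, trace_mul_comm, Matrix.mul_assoc, matPow_mul_matPow hσ.1, h2,
    Complex.ofReal_re, ← Complex.one_re, ← h1]
  refine Finset.sum_le_sum fun i _ => Finset.sum_le_sum fun j _ => ?_
  by_cases hij : overlap hρ.1.1 hσ.1.1 i j = 0
  · simp [hij]
  rcases (hρ.1.eigenvalues_nonneg i).eq_or_lt with hi | hi
  · simp [← hi]
  have hj := eigenvalues_ne_zero_of_suppLE hρ.1.1 hσ.1.1 hs hij hi.ne'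
  have hj' := (hσ.1.eigenvalues_nonneg j).lt_of_ne' hj
  have hj1 : hσ.1.1.eigenvalues j ≤ 1 := by
    simpa [hσ.2] using eigenvalues_le_of_trace hσ.1 j
  rw [if_neg hj]
  refine mul_le_mul_of_nonneg_right ?_ (Complex.normSq_nonneg _)
  exact le_mul_of_one_le_right hi.le
    (Real.one_le_rpow_of_pos_of_le_one_of_nonpos hj' hj1 (by linarith))

lemma one_le_card_rpow_mul_trace_matPow (hA : A.PosSemidef) (h : 1 ≤ A.trace.re) {α : ℝ}
    (hα : 1 ≤ α) : 1 ≤ (Fintype.card n : ℝ) ^ (α - 1) * (matPow A α).trace.re := by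
  rw [trace_matPow hA (by linarith)]
  have h1 := Real.rpow_sum_le_const_mul_sum_rpow_of_nonneg Finset.univ hα
    (fun i _ => hA.eigenvalues_nonneg i)
  have h2 : ∑ i, hA.1.eigenvalues i = A.trace.re := by
    rw [hA.1.trace_eq_sum_eigenvalues]
    simp
  rw [h2] at h1
  exact (Real.one_le_rpow h (by linarith)).trans h1

lemma posSemidef_smul_one_sub (hA : A.PosSemidef) {α : ℝ} (hα : 0 < α) :
    ((matPow A α).trace.re ^ (1 / α) • (1 : Matrix n n ℂ) - A).PosSemidef := by
  rw [trace_matPow hA hα]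
  have := posSemidef_matFun hA.1
    (f := fun x => (∑ i, hA.1.eigenvalues i ^ α) ^ (1 / α) * 1 - x) fun i => by
      have h0 := hA.eigenvalues_nonneg
      have h1 : hA.1.eigenvalues i ^ α ≤ ∑ i, hA.1.eigenvalues i ^ α :=
        Finset.single_le_sum (f := fun i => hA.1.eigenvalues i ^ α)
          (fun j _ => Real.rpow_nonneg (h0 j) _) (Finset.mem_univ i)
      have h2 := Real.rpow_le_rpow (Real.rpow_nonneg (h0 i) _) h1 (one_div_nonneg.2 hα.le)
      rw [← Real.rpow_mul (h0 i), mul_one_div_cancel hα.ne', Real.rpow_one] at h2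
      simpa using h2
  rwa [matFun_sub hA.1, matFun_const_mul hA.1, matFun_one hA.1, matFun_id_s3 hA.1] at this

lemma exists_loewnerLE_rpow_trace (hρ : IsDensityMatrix ρ) (hσ : IsDensityMatrix σ)
    (hs : suppLE ρ σ) : ∃ K : ℝ, 0 < K ∧ ∀ α : ℝ, 1 < α → loewnerLE ρ
      (((matPow (matPow σ ((1 - α) / (2 * α)) * ρ * matPow σ ((1 - α) / (2 * α))) α).trace.re
        * K) ^ (1 / α) • σ) := by
  have hq := hσ.1.eigenvalues_nonneg
  have hinv : ∀ j, 0 ≤ (hσ.1.1.eigenvalues j)⁻¹ := fun j => inv_nonneg.2 (hq j)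
  refine ⟨1 + ∑ j, (hσ.1.1.eigenvalues j)⁻¹,
    add_pos_of_pos_of_nonneg one_pos (Finset.sum_nonneg fun j _ => hinv j), fun α hα => ?_⟩
  set K := 1 + ∑ j, (hσ.1.1.eigenvalues j)⁻¹
  set t := (1 - α) / (2 * α) with ht
  have hα0 : 0 < α := by linarith
  have hA := posSemidef_sandwich hρ.1 hσ.1.1 t
  have hQ : 0 ≤ (matPow (matPow σ t * ρ * matPow σ t) α).trace.re := by
    rw [trace_matPow hA hα0]
    exact Finset.sum_nonneg fun i _ => Real.rpow_nonneg (hA.eigenvalues_nonneg i) _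
  have hK : 0 ≤ K := add_nonneg zero_le_one (Finset.sum_nonneg fun j _ => hinv j)
  have h1 := (posSemidef_smul_one_sub hA hα0).conjTranspose_mul_mul_same (matPow σ (-t))
  rw [Real.mul_rpow hQ hK]
  set c := (matPow (matPow σ t * ρ * matPow σ t) α).trace.re ^ (1 / α)
  have hc : 0 ≤ c := Real.rpow_nonneg hQ _
  have h2 : (K ^ (1 / α) • σ - matPow σ (-t + -t)).PosSemidef := by
    have := posSemidef_matFun hσ.1.1
      (f := fun x => K ^ (1 / α) * x - if x = 0 then 0 else x ^ (-t + -t)) fun i => by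
        split_ifs with h
        · simp [h]
        · have hpos := (hq i).lt_of_ne' h
          have hle : (hσ.1.1.eigenvalues i)⁻¹ ≤ K :=
            (Finset.single_le_sum (f := fun j => (hσ.1.1.eigenvalues j)⁻¹)
              (fun j _ => hinv j) (Finset.mem_univ i)).trans (by simp [K])
          have hexp : -t + -t = -(1 / α) + 1 := by rw [ht]; field_simp; ring
          rw [sub_nonneg, hexp, Real.rpow_add_one h, Real.rpow_neg (hq i), ← Real.inv_rpow (hq i)]
          exact mul_le_mul_of_nonneg_right
            (Real.rpow_le_rpow (hinv i) hle (one_div_nonneg.2 hα0.le)) (hq i)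
    rwa [matFun_sub hσ.1.1, matFun_const_mul hσ.1.1, matFun_id_s3 hσ.1.1, ← matPow] at this
  have hr := (suppLE_iff_mul_supp hσ.1.1).1 hs
  have hl : supp σ * ρ = ρ := by
    have := congrArg conjTranspose hr
    rwa [conjTranspose_mul, hρ.1.1.eq, (isHermitian_supp hσ.1.1).eq] at this
  have h3 : matPow σ (-t) * (matPow σ t * ρ * matPow σ t) * matPow σ (-t) = ρ := by
    have e1 : matPow σ (-t) * matPow σ t = supp σ := by
      rw [matPow_mul_matPow hσ.1, neg_add_cancel, matPow_zero]
    have e2 : matPow σ t * matPow σ (-t) = supp σ := by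
      rw [matPow_mul_matPow hσ.1, add_neg_cancel, matPow_zero]
    rw [← Matrix.mul_assoc, ← Matrix.mul_assoc, e1, hl, Matrix.mul_assoc, e2, hr]
  rw [(isHermitian_matPow hσ.1.1 _).eq, Matrix.mul_sub, Matrix.sub_mul, h3, Matrix.mul_smul,
    smul_mul, Matrix.mul_one, matPow_mul_matPow hσ.1] at h1
  have h4 := (h2.smul hc).add h1
  rw [smul_sub, smul_smul, sub_add_sub_cancel] at h4
  exact h4

lemma exists_eq_conjTranspose_mul_self (hA : A.PosSemidef) : ∃ B, A = Bᴴ * B := by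
  refine ⟨matFun A Real.sqrt, ?_⟩
  rw [(isHermitian_matFun hA.1 _).eq, matFun_mul_matFun_s3 hA.1]
  conv_lhs => rw [← matFun_id_s3 hA.1]
  exact matFun_congr hA.1 fun i => (Real.mul_self_sqrt (hA.eigenvalues_nonneg i)).symm

lemma eq_smul_of_le_trace (hρ : IsDensityMatrix ρ) (hσ : σ.PosSemidef) (hs : suppLE ρ σ)
    (hγ : 0 < γ) (h : loewnerLE ρ (γ • σ))
    (htr : γ ≤ (ρ * matPow σ (-1 / 2) * ρ * matPow σ (-1 / 2)).trace.re) :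
    ρ = γ • (σ * supp ρ) := by
  have hr := (suppLE_iff_mul_supp hσ.1).1 hs
  have hτ := (isHermitian_matPow hσ.1 (-1 / 2)).eq
  have hrH := (isHermitian_matPow hσ.1 (1 / 2)).eq
  have hστ : σ * matPow σ (-1 / 2) = matPow σ (1 / 2) := by
    conv_lhs => enter [1]; rw [← matPow_one hσ.1]
    rw [matPow_mul_matPow hσ]
    norm_num
  have hrr : matPow σ (1 / 2) * matPow σ (1 / 2) = σ := by
    rw [matPow_mul_matPow hσ, add_halves, matPow_one hσ.1]
  have hrτ : matPow σ (1 / 2) * matPow σ (-1 / 2) = supp σ := by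
    rw [matPow_mul_matPow hσ, ← matPow_zero]
    norm_num
  have hτr : matPow σ (-1 / 2) * matPow σ (1 / 2) = supp σ := by
    rw [matPow_mul_matPow hσ, ← matPow_zero]
    norm_num
  have hρH := hρ.1.1.eq
  have hρtr := hρ.2
  have hzero : (γ • σ - ρ) * matPow σ (-1 / 2) * ρ = 0 := by
    generalize matPow σ (-1 / 2) = τ at *
    generalize matPow σ (1 / 2) = r at *
    obtain ⟨B, hB⟩ := exists_eq_conjTranspose_mul_self hρ.1
    obtain ⟨C, hC⟩ := exists_eq_conjTranspose_mul_self h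
    have e : (C * τ * Bᴴ)ᴴ * (C * τ * Bᴴ) = B * (τ * (γ • σ - ρ) * τ * Bᴴ) := by
      rw [hC]
      simp only [conjTranspose_mul, conjTranspose_conjTranspose, hτ, Matrix.mul_assoc]
    have e' : ((C * τ * Bᴴ)ᴴ * (C * τ * Bᴴ)).trace = γ - (ρ * τ * ρ * τ).trace := by
      rw [e, trace_mul_comm, Matrix.mul_assoc, ← hB, Matrix.mul_sub, Matrix.sub_mul,
        Matrix.sub_mul, Matrix.mul_smul, smul_mul, smul_mul, Matrix.mul_assoc τ σ τ, hστ, hτr,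
        trace_sub, trace_smul, trace_mul_comm, hr, hρtr, Complex.real_smul, mul_one,
        trace_mul_comm]
      simp only [Matrix.mul_assoc]
    have hpsd := posSemidef_conjTranspose_mul_self (C * τ * Bᴴ)
    have h0 : ((C * τ * Bᴴ)ᴴ * (C * τ * Bᴴ)).trace = 0 := by
      have hn := Complex.nonneg_iff.1 hpsd.trace_nonneg
      refine Complex.ext (le_antisymm ?_ hn.1) hn.2.symm
      rw [e']
      simpa using htr
    rw [trace_conjTranspose_mul_self_eq_zero_iff] at h0
    conv_lhs => rw [hC, hB]
    have : Cᴴ * C * τ * (Bᴴ * B) = Cᴴ * (C * τ * Bᴴ) * B := by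
      simp only [Matrix.mul_assoc]
    rw [this, h0, Matrix.mul_zero, Matrix.zero_mul]
  have hcomm : γ • (σ * ρ) = ρ * ρ := by
    generalize matPow σ (-1 / 2) = τ at *
    generalize matPow σ (1 / 2) = r at *
    rw [Matrix.sub_mul, Matrix.sub_mul, smul_mul, smul_mul, hστ, sub_eq_zero] at hzero
    have hzero' := congrArg conjTranspose hzero
    rw [conjTranspose_smul, star_trivial, conjTranspose_mul, conjTranspose_mul, conjTranspose_mul,
      hρH, hrH, hτ, ← Matrix.mul_assoc, ← hzero] at hzero'
    have hcr : ρ * r = r * ρ := smul_right_injective _ hγ.ne' hzero'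
    rw [← hrr, Matrix.mul_assoc, ← Matrix.mul_smul, hzero, ← Matrix.mul_assoc, ← Matrix.mul_assoc,
      ← hcr, Matrix.mul_assoc ρ r, hrτ, hr]
  have hcomm' : matFun ρ (fun x => γ * x) * matFun σ (fun x => x) =
      matFun ρ (fun x => x * x) * matFun σ (fun _ => 1) := by
    have := congrArg conjTranspose hcomm
    rw [conjTranspose_smul, star_trivial, conjTranspose_mul, conjTranspose_mul, hρH, hσ.1.eq] at this
    rw [matFun_mul_matFun_one ρ hσ.1, matFun_const_mul hρ.1.1, ← matFun_mul_matFun_s3 hρ.1.1,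
      matFun_id_s3 hρ.1.1, matFun_id_s3 hσ.1, smul_mul, this]
  rw [eq_smul_mul_supp_iff hρ.1.1 hσ.1]
  rw [matFun_mul_matFun_eq_iff hρ.1.1 hσ.1] at hcomm'
  intro i j hij hi
  have := hcomm' i j hij
  refine mul_left_cancel₀ hi ?_
  linarith

lemma exists_eq_smul_of_log_Qstar_affine (hρ : IsDensityMatrix ρ) (hσ : IsDensityMatrix σ)
    (hs : suppLE ρ σ) {a b : ℝ}
    (h : ∀ s ∈ Set.Ioi (0 : ℝ), (Qstar (s + 1) ρ σ).log = ((a * s + b : ℝ) : EReal)) :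
    ∃ γ : ℝ, 0 < γ ∧ ρ = γ • (σ * supp ρ) := by
  have hQ : ∀ s : ℝ, 0 < s → (matPow (matPow σ ((1 - (s + 1)) / (2 * (s + 1))) * ρ *
      matPow σ ((1 - (s + 1)) / (2 * (s + 1)))) (s + 1)).trace.re = Real.exp (a * s + b) := by
    intro s hs0
    have h1 := h s hs0
    rw [Qstar_of_suppLE hs, ENNReal.log_ofReal] at h1
    split_ifs at h1 with h2
    · exact absurd h1 (EReal.bot_ne_coe _)
    · rw [← EReal.coe_eq_coe_iff.1 h1, Real.exp_log (not_le.1 h2)]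
  have hcard : 0 < (Fintype.card n : ℝ) := by
    have : Nonempty n := by
      by_contra hn
      rw [not_nonempty_iff] at hn
      simpa [trace] using hρ.2
    exact_mod_cast Fintype.card_pos
  have hb : 0 ≤ b := by
    have hlow : ∀ s : ℝ, 0 < s → 0 ≤ (Real.log (Fintype.card n) + a) * s + b := by
      intro s hs0
      have ht : (1 - (s + 1)) / (2 * (s + 1)) ≤ 0 :=
        div_nonpos_of_nonpos_of_nonneg (by linarith) (by linarith)
      have h1 := one_le_card_rpow_mul_trace_matPow (posSemidef_sandwich hρ.1 hσ.1.1 _)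
        (one_le_trace_sandwich hρ hσ hs ht) (α := s + 1) (by linarith)
      rw [hQ s hs0, Real.rpow_def_of_pos hcard, ← Real.exp_add, Real.one_le_exp_iff] at h1
      linarith
    have hlim : Filter.Tendsto (fun s : ℝ => (Real.log (Fintype.card n) + a) * s + b)
        (nhdsWithin 0 (Set.Ioi 0)) (nhds b) := by
      refine Filter.Tendsto.mono_left ?_ nhdsWithin_le_nhds
      exact Continuous.tendsto' (by fun_prop) _ _ (by simp)
    exact ge_of_tendsto hlim (Filter.eventually_of_mem self_mem_nhdsWithin fun s => hlow s)
  obtain ⟨K, hK, hKle⟩ := exists_loewnerLE_rpow_trace hρ hσ hs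
  have hle : loewnerLE ρ (Real.exp a • σ) := by
    have hlim : Filter.Tendsto (fun s : ℝ => Real.exp (a + (b + Real.log K - a) / (s + 1)))
        Filter.atTop (nhds (Real.exp a)) := by
      refine (Real.continuous_exp.tendsto a).comp ?_
      simpa using tendsto_const_nhds.add (Filter.Tendsto.const_div_atTop
        (Filter.tendsto_atTop_add_const_right _ (1 : ℝ) Filter.tendsto_id) (b + Real.log K - a))
    refine ((isClosed_setOf_loewnerLE ρ σ).mem_of_tendsto hlim ?_).2
    filter_upwards [Filter.eventually_gt_atTop 0] with s hs0
    have h1 := hKle (s + 1) (by linarith)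
    rw [hQ s hs0] at h1
    have h2 : (Real.exp (a * s + b) * K) ^ (1 / (s + 1)) =
        Real.exp (a + (b + Real.log K - a) / (s + 1)) := by
      have hs1 : s + 1 ≠ 0 := by linarith
      rw [Real.rpow_def_of_pos (by positivity), Real.log_mul (Real.exp_ne_zero _) hK.ne',
        Real.log_exp]
      congr 1
      field_simp
      ring
    rw [h2] at h1
    exact ⟨(Real.exp_pos _).le, h1⟩
  refine ⟨Real.exp a, Real.exp_pos a, eq_smul_of_le_trace hρ hσ.1 hs (Real.exp_pos a) hle ?_⟩
  have h2 := hQ 1 one_pos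
  have hA := posSemidef_sandwich hρ.1 hσ.1.1 ((1 - (1 + 1)) / (2 * (1 + 1)))
  have hsq : matPow (matPow σ ((1 - (1 + 1)) / (2 * (1 + 1))) * ρ *
      matPow σ ((1 - (1 + 1)) / (2 * (1 + 1)))) (1 + 1) =
      (matPow σ ((1 - (1 + 1)) / (2 * (1 + 1))) * ρ * matPow σ ((1 - (1 + 1)) / (2 * (1 + 1)))) *
      (matPow σ ((1 - (1 + 1)) / (2 * (1 + 1))) * ρ *
        matPow σ ((1 - (1 + 1)) / (2 * (1 + 1)))) := by
    rw [← matPow_mul_matPow hA, matPow_one hA.1]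
  have hττ : matPow σ ((1 - (1 + 1)) / (2 * (1 + 1))) * matPow σ ((1 - (1 + 1)) / (2 * (1 + 1))) =
      matPow σ (-1 / 2) := by
    rw [matPow_mul_matPow hσ.1]
    norm_num
  rw [hsq] at h2
  generalize matPow σ ((1 - (1 + 1)) / (2 * (1 + 1))) = κ at *
  have h3 : (ρ * matPow σ (-1 / 2) * ρ * matPow σ (-1 / 2)).trace =
      (κ * ρ * κ * (κ * ρ * κ)).trace := by
    rw [← hττ, ← Matrix.mul_assoc _ κ κ, trace_mul_comm]
    simp only [Matrix.mul_assoc]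
  rw [h3, h2, Real.exp_le_exp]
  linarith

end Renyi

end QRD


open QRD in
/-- For density matrices `ρ`, `σ` on `ℂ^d` with `s(ρ) ≤ s(σ)`, the following are equivalent:
(a) `s ↦ ψ(s) = log Q*_{s+1}(ρ‖σ)` is affine on `(0,∞)`;
(b) `D(ρ‖σ) = D_max(ρ‖σ)`;
(c) `ρσ = σρ` and `ρ = γ·σ·s(ρ)` for some `γ > 0`;
(d) `σ·s(ρ) = s(ρ)·σ` and `ρ = γ·σ·s(ρ)` for some `γ > 0`. -/
theorem relEntropy_eq_maxRelEntropy_tfae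
    {d : ℕ} (ρ σ : Matrix (Fin d) (Fin d) ℂ)
    (hρ : IsDensityMatrix ρ) (hσ : IsDensityMatrix σ)
    (hsupp : suppLE ρ σ) :
    List.TFAE
      [(∃ a b : ℝ, ∀ s ∈ Set.Ioi (0 : ℝ),
          (Qstar (s + 1) ρ σ).log = ((a * s + b : ℝ) : EReal)),
       Drel ρ σ = Dmax ρ σ,
       (ρ * σ = σ * ρ ∧ ∃ γ : ℝ, 0 < γ ∧ ρ = γ • (σ * supp ρ)),
       (σ * supp ρ = supp ρ * σ ∧ ∃ γ : ℝ, 0 < γ ∧ ρ = γ • (σ * supp ρ))] := by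
  tfae_have 3 → 4
  | ⟨_, γ, hγ, h⟩ => ⟨mul_supp_comm_of_eq_smul hρ.1.1 hσ.1.1 hγ h, γ, hγ, h⟩
  tfae_have 4 → 3
  | ⟨_, γ, hγ, h⟩ => ⟨mul_comm_of_eq_smul hρ.1.1 hσ.1.1 hγ h, γ, hγ, h⟩
  tfae_have 1 → 4 := by
    rintro ⟨a, b, h⟩
    obtain ⟨γ, hγ, h⟩ := exists_eq_smul_of_log_Qstar_affine hρ hσ hsupp h
    exact ⟨mul_supp_comm_of_eq_smul hρ.1.1 hσ.1.1 hγ h, γ, hγ, h⟩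
  tfae_have 2 → 4 := by
    intro h
    obtain ⟨γ, hγ, h⟩ := exists_eq_smul_of_Drel_eq_Dmax hρ hσ hsupp h
    exact ⟨mul_supp_comm_of_eq_smul hρ.1.1 hσ.1.1 hγ h, γ, hγ, h⟩
  tfae_have 4 → 1 := by
    rintro ⟨_, γ, hγ, h⟩
    refine ⟨Real.log γ, 0, fun s hs => ?_⟩
    rw [Qstar_of_eq_smul hρ hσ.1.1 hsupp hγ h (add_pos hs one_pos), add_sub_cancel_right,
      ENNReal.log_ofReal_of_pos (Real.rpow_pos_of_pos hγ s), Real.log_rpow hγ, add_zero, mul_comm]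
  tfae_have 4 → 2
  | ⟨_, γ, hγ, h⟩ => Drel_eq_Dmax_of_eq_smul hρ hσ.1 hsupp hγ h
  tfae_finish
end
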